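/- Let I ⊆ S = K[t_1,…,t_s] be a monomial ideal and, for each k ≥ 1, let \overline{I^k} denote the ideal of S generated by all monomials t^a such that (t^a)^p ∈ I^{pk} for some integer p ≥ 1 (the integral closure of I^k). Then \overline{I^n} = I · \overline{I^{n-1}} for all n ≥ s; in particular, the filtration of integral closures of powers of I stabilizes at n = s = dim S. -/

import Mathlib

open MvPolynomial

/-- A nonnegative rational combination of finitely many vectors of `ℕ^σ`, of total weight at least
`n` and bounded above by `a`, can be replaced by one that uses at most `|σ|` of the vectors. -/
theorem exists_card_le_combination {σ : Type*} [Fintype σ] [Nonempty σ]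
    {n : ℚ} (hn : 0 ≤ n) (a : σ → ℚ) (ha : 0 ≤ a) (T : Finset (σ → ℕ)) (c : (σ → ℕ) → ℚ)
    (hc : ∀ v ∈ T, 0 ≤ c v) (hsum : n ≤ ∑ v ∈ T, c v)
    (hle : ∀ i, ∑ v ∈ T, c v * (v i : ℚ) ≤ a i) :
    ∃ T' ⊆ T, T'.card ≤ Fintype.card σ ∧ ∃ c' : (σ → ℕ) → ℚ, (∀ v ∈ T', 0 ≤ c' v) ∧
      n ≤ ∑ v ∈ T', c' v ∧ ∀ i, ∑ v ∈ T', c' v * (v i : ℚ) ≤ a i := by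
  classical
  induction hk : T.card using Nat.strong_induction_on generalizing T c with
  | _ k ih =>
  subst hk
  by_cases hcard : T.card ≤ Fintype.card σ
  · exact ⟨T, subset_rfl, hcard, c, hc, hsum, hle⟩
  by_cases h0 : (0 : σ → ℕ) ∈ T
  · refine ⟨{0}, by simpa using h0, ?_, fun _ => n, fun _ _ => hn, by simp, fun i => ?_⟩
    · simpa using Nat.succ_le_of_lt (Fintype.card_pos (α := σ))
    · simpa using ha i
  obtain ⟨m, hm, hmsum, w, hwT, hw⟩ : ∃ m : (σ → ℕ) → ℚ,
      (∀ i, ∑ v ∈ T, m v * (v i : ℚ) = 0) ∧ 0 ≤ ∑ v ∈ T, m v ∧ ∃ v ∈ T, m v ≠ 0 := by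
    let φ : (σ → ℕ) → (σ → ℚ) := fun v i => v i
    have hφ : Function.Injective φ := fun u v huv => by
      funext i
      exact Nat.cast_injective (R := ℚ) (congrFun huv i)
    obtain ⟨f, hf, x, hx, hfx⟩ := Module.exists_nontrivial_relation_of_finrank_lt_card
      (R := ℚ) (t := T.image φ) (by
        rw [Finset.card_image_of_injective _ hφ, Module.finrank_fintype_fun_eq_card]
        omega)
    rw [Finset.sum_image hφ.injOn] at hf
    obtain ⟨w, hwT, rfl⟩ := Finset.mem_image.1 hx
    have hf' : ∀ i, ∑ v ∈ T, f (φ v) * (v i : ℚ) = 0 := fun i => by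
      simpa [Finset.sum_apply, φ] using congrFun hf i
    rcases le_total 0 (∑ v ∈ T, f (φ v)) with h | h
    · exact ⟨fun v => f (φ v), hf', h, w, hwT, hfx⟩
    · refine ⟨fun v => -f (φ v), fun i => ?_, ?_, w, hwT, neg_ne_zero.2 hfx⟩
      · simp [hf' i]
      · simpa using h
  have hneg : (T.filter fun v => m v < 0).Nonempty := by
    by_contra hempty
    have hm0 : ∀ v ∈ T, 0 ≤ m v := fun v hv => by
      by_contra hv'
      exact hempty ⟨v, Finset.mem_filter.2 ⟨hv, not_le.1 hv'⟩⟩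
    obtain ⟨i, hi⟩ : ∃ i, w i ≠ 0 := by
      by_contra! hw0
      exact h0 ((funext hw0 : w = 0) ▸ hwT)
    have := (Finset.sum_eq_zero_iff_of_nonneg
      (fun v hv => mul_nonneg (hm0 v hv) (Nat.cast_nonneg (v i)))).1 (hm i) w hwT
    simp_all
  obtain ⟨u, hu, hmin⟩ := Finset.exists_min_image _ (fun v => c v / -m v) hneg
  obtain ⟨huT, hmu⟩ := Finset.mem_filter.1 hu
  set t := c u / -m u with ht
  have ht0 : 0 ≤ t := div_nonneg (hc u huT) (by linarith)
  have hu0 : c u + t * m u = 0 := by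
    rw [ht, div_neg, neg_mul, div_mul_cancel₀ _ hmu.ne, add_neg_cancel]
  have hnonneg : ∀ v ∈ T.erase u, 0 ≤ c v + t * m v := fun v hv => by
    have hvT := Finset.mem_of_mem_erase hv
    rcases le_or_gt 0 (m v) with hv0 | hv0
    · exact add_nonneg (hc v hvT) (mul_nonneg ht0 hv0)
    · have := (le_div_iff₀ (by linarith)).1 (hmin v (Finset.mem_filter.2 ⟨hvT, hv0⟩))
      linarith
  have hsum' : n ≤ ∑ v ∈ T.erase u, (c v + t * m v) := by
    rw [Finset.sum_erase (f := fun v => c v + t * m v) _ hu0, Finset.sum_add_distrib, ← Finset.mul_sum]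
    linarith [mul_nonneg ht0 hmsum]
  have hle' : ∀ i, ∑ v ∈ T.erase u, (c v + t * m v) * (v i : ℚ) ≤ a i := fun i => by
    rw [Finset.sum_erase _ (by simp [hu0])]
    simpa [add_mul, Finset.sum_add_distrib, mul_assoc, ← Finset.mul_sum, hm i] using hle i
  obtain ⟨T', hT', h⟩ := ih _ (Finset.card_erase_lt_of_mem huT) (T.erase u) _ hnonneg hsum' hle' rfl
  exact ⟨T', hT'.trans (Finset.erase_subset _ _), h⟩

/-- A nonnegative rational combination of total weight at least `n ≥ |σ|` can be chosen so that one
of its vectors has weight at least `1`; lowering that weight by `1` leaves total weight at least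
`n - 1`. -/
theorem exists_sub_combination {σ : Type*} [Fintype σ] [Nonempty σ]
    {n : ℕ} (hn : Fintype.card σ ≤ n) (a : σ → ℕ) (T : Finset (σ → ℕ)) (c : (σ → ℕ) → ℚ)
    (hc : ∀ v ∈ T, 0 ≤ c v) (hsum : (n : ℚ) ≤ ∑ v ∈ T, c v)
    (hle : ∀ i, ∑ v ∈ T, c v * (v i : ℚ) ≤ a i) :
    ∃ u ∈ T, u ≤ a ∧ ∃ T' ⊆ T, ∃ c' : (σ → ℕ) → ℚ, (∀ v ∈ T', 0 ≤ c' v) ∧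
      ((n - 1 : ℕ) : ℚ) ≤ ∑ v ∈ T', c' v ∧
      ∀ i, ∑ v ∈ T', c' v * (v i : ℚ) ≤ ((a - u) i : ℕ) := by
  classical
  obtain ⟨T', hT', hcard, c', hc', hsum', hle'⟩ := exists_card_le_combination
    (Nat.cast_nonneg n) (fun i => (a i : ℚ)) (fun i => Nat.cast_nonneg _) T c hc hsum hle
  have hn0 : 1 ≤ n := Fintype.card_pos.trans_le hn
  have hne : T'.Nonempty := by
    rw [Finset.nonempty_iff_ne_empty]
    rintro rfl
    have : (n : ℚ) ≤ 0 := by simpa using hsum'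
    have : n ≤ 0 := by exact_mod_cast this
    omega
  obtain ⟨u, hu, hu1⟩ : ∃ u ∈ T', 1 ≤ c' u := by
    refine Finset.exists_le_of_sum_le hne (f := fun _ => (1 : ℚ)) (le_trans ?_ hsum')
    simpa using hcard.trans hn
  have hua : u ≤ a := fun i => by
    have h1 := Finset.single_le_sum (f := fun v => c' v * (v i : ℚ))
      (fun v hv => mul_nonneg (hc' v hv) (Nat.cast_nonneg _)) hu
    have h2 : (u i : ℚ) ≤ c' u * u i := le_mul_of_one_le_left (Nat.cast_nonneg _) hu1
    exact_mod_cast h2.trans (h1.trans (hle' i))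
  refine ⟨u, hT' hu, hua, T', hT', fun v => c' v - if v = u then 1 else 0, fun v hv => ?_, ?_,
    fun i => ?_⟩
  · dsimp only
    split_ifs with h
    · subst h
      linarith
    · simpa using hc' v hv
  · rw [Finset.sum_sub_distrib, Finset.sum_ite_eq' T' u, if_pos hu]
    push_cast [hn0]
    linarith
  · have := hle' i
    simp only [sub_mul, Finset.sum_sub_distrib, ite_mul, one_mul, zero_mul,
      Finset.sum_ite_eq', if_pos hu, Pi.sub_apply]
    rw [Nat.cast_sub (hua i)]
    linarith

section MonomialIdeal

variable {σ : Type*} [Fintype σ] (R : Type*) [CommRing R]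

theorem prod_X_pow_eq_monomial_equivFunOnFinite (a : σ → ℕ) :
    (∏ i, X i ^ a i : MvPolynomial σ R) = monomial (Finsupp.equivFunOnFinite.symm a) 1 := by
  rw [monomial_eq, Finsupp.prod_fintype _ _ (by simp)]
  simp

theorem prod_X_pow_add (a b : σ → ℕ) :
    (∏ i, X i ^ (a + b) i : MvPolynomial σ R) = (∏ i, X i ^ a i) * ∏ i, X i ^ b i := by
  simp [pow_add, Finset.prod_mul_distrib]

theorem prod_X_pow_nsmul (p : ℕ) (a : σ → ℕ) :
    (∏ i, X i ^ (p • a) i : MvPolynomial σ R) = (∏ i, X i ^ a i) ^ p := by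
  simp [← Finset.prod_pow, mul_comm p, pow_mul]

theorem prod_X_pow_sum {ι : Type*} (T : Finset ι) (f : ι → σ → ℕ) :
    (∏ i, X i ^ (∑ v ∈ T, f v) i : MvPolynomial σ R) = ∏ v ∈ T, ∏ i, X i ^ f v i := by
  rw [Finset.prod_comm]
  simp [Finset.prod_pow_eq_pow_sum]

variable {R}

/-- A monomial lying in an ideal generated by monomials is divisible by one of them. -/
theorem exists_le_of_prod_X_pow_mem_span [Nontrivial R] {B : Set (σ → ℕ)} {a : σ → ℕ}
    (h : (∏ i, X i ^ a i : MvPolynomial σ R) ∈ Ideal.span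
      ((fun b : σ → ℕ => (∏ i, X i ^ b i : MvPolynomial σ R)) '' B)) :
    ∃ b ∈ B, b ≤ a := by
  have himage : (fun b : σ → ℕ => (∏ i, X i ^ b i : MvPolynomial σ R)) '' B =
      (fun b => monomial b 1) '' (Finsupp.equivFunOnFinite.symm '' B) := by
    rw [Set.image_image]
    exact Set.image_congr fun b _ => prod_X_pow_eq_monomial_equivFunOnFinite R b
  rw [himage, prod_X_pow_eq_monomial_equivFunOnFinite, mem_ideal_span_monomial_image] at h
  obtain ⟨_, ⟨b, hb, rfl⟩, hba⟩ := h (Finsupp.equivFunOnFinite.symm a) (by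
    classical
    simp [coeff_monomial])
  exact ⟨b, hb, fun i => hba i⟩

theorem span_prod_X_pow_pow_le (A : Set (σ → ℕ)) (m : ℕ) :
    Ideal.span ((fun b : σ → ℕ => (∏ i, X i ^ b i : MvPolynomial σ R)) '' A) ^ m ≤
      Ideal.span ((fun b : σ → ℕ => (∏ i, X i ^ b i : MvPolynomial σ R)) ''
        {b | ∃ c : (σ → ℕ) →₀ ℕ, ↑c.support ⊆ A ∧ c.sum (fun _ k => k) = m ∧
          c.sum (fun v k => k • v) = b}) := by
  classical
  induction m with
  | zero =>
    rw [pow_zero, Ideal.one_eq_top, top_le_iff, Ideal.eq_top_iff_one]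
    exact Ideal.subset_span ⟨0, ⟨0, by simp⟩, by simp⟩
  | succ m ih =>
    rw [pow_succ]
    refine (Ideal.mul_mono_left ih).trans ?_
    rw [Ideal.span_mul_span', Ideal.span_le]
    rintro _ ⟨_, ⟨_, ⟨c, hcA, hcm, rfl⟩, rfl⟩, _, ⟨v, hv, rfl⟩, rfl⟩
    refine Ideal.subset_span ⟨_, ⟨c + Finsupp.single v 1, ?_, ?_, rfl⟩, ?_⟩
    · intro x hx
      rcases Finset.mem_union.1 (Finsupp.support_add hx) with h | h
      · exact hcA h
      · rw [Finset.mem_singleton.1 (Finsupp.support_single_subset h)]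
        exact hv
    · rw [Finsupp.sum_add_index' (by simp) (by simp), hcm]
      simp
    · rw [Finsupp.sum_add_index' (by simp) (fun _ _ _ => add_smul _ _ _)]
      simp only [Finsupp.sum_single_index, zero_smul, one_smul]
      exact prod_X_pow_add R _ _

/-- The exponents `a` with `(t^a)^p ∈ I^{pk}` for some `p ≥ 1` are those bounding a nonnegative
rational combination, of total weight at least `k`, of exponents of generators of `I`. -/
theorem exists_pow_mem_pow_iff [Nontrivial R] (A : Set (σ → ℕ)) (a : σ → ℕ) (k : ℕ) :
    (∃ p : ℕ, 1 ≤ p ∧ (∏ i, X i ^ a i : MvPolynomial σ R) ^ p ∈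
      Ideal.span ((fun b : σ → ℕ => (∏ i, X i ^ b i : MvPolynomial σ R)) '' A) ^ (p * k)) ↔
    ∃ T : Finset (σ → ℕ), ↑T ⊆ A ∧ ∃ c : (σ → ℕ) → ℚ, (∀ v ∈ T, 0 ≤ c v) ∧
      (k : ℚ) ≤ ∑ v ∈ T, c v ∧ ∀ i, ∑ v ∈ T, c v * (v i : ℚ) ≤ a i := by
  constructor
  · rintro ⟨p, hp, h⟩
    rw [← prod_X_pow_nsmul] at h
    obtain ⟨_, ⟨c, hcA, hcs, rfl⟩, hle⟩ :=
      exists_le_of_prod_X_pow_mem_span (span_prod_X_pow_pow_le A _ h)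
    have hp0 : (0 : ℚ) < p := by exact_mod_cast hp
    refine ⟨c.support, hcA, fun v => c v / p, fun v _ => by positivity, ?_, fun i => ?_⟩
    · rw [← Finset.sum_div, le_div_iff₀ hp0]
      have : ∑ v ∈ c.support, c v = p * k := hcs
      rw [mul_comm]
      exact_mod_cast this.ge
    · have h1 : ∑ v ∈ c.support, c v * v i ≤ p * a i := by
        simpa [Finsupp.sum] using hle i
      simp only [div_mul_eq_mul_div]
      rw [← Finset.sum_div, div_le_iff₀ hp0, mul_comm (a i : ℚ)]
      exact_mod_cast h1
  · rintro ⟨T, hTA, c, hc, hsum, hle⟩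
    obtain ⟨p, hp, m, hm⟩ : ∃ p : ℕ, 1 ≤ p ∧ ∃ m : (σ → ℕ) → ℕ, ∀ v ∈ T, p * c v = m v := by
      refine ⟨∏ v ∈ T, (c v).den, Finset.prod_pos fun v _ => (c v).den_pos,
        fun v => (∏ v ∈ T, (c v).den) / (c v).den * (c v).num.toNat, fun v hv => ?_⟩
      obtain ⟨q, hq⟩ := Finset.dvd_prod_of_mem (fun v => (c v).den) hv
      have hnum : ((c v).num.toNat : ℚ) = (c v).num := by
        exact_mod_cast Int.toNat_of_nonneg (Rat.num_nonneg.2 (hc v hv))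
      dsimp only
      rw [hq, Nat.mul_div_cancel_left _ (c v).den_pos]
      push_cast
      rw [hnum, ← Rat.mul_den_eq_num (c v)]
      ring
    refine ⟨p, hp, ?_⟩
    have hsum' : p * k ≤ ∑ v ∈ T, m v := by
      have h1 := mul_le_mul_of_nonneg_left hsum (Nat.cast_nonneg (α := ℚ) p)
      rw [Finset.mul_sum, Finset.sum_congr rfl hm] at h1
      exact_mod_cast h1
    have hle' : ∑ v ∈ T, m v • v ≤ p • a := fun i => by
      have h1 := mul_le_mul_of_nonneg_left (hle i) (Nat.cast_nonneg (α := ℚ) p)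
      simp only [Finset.mul_sum, ← mul_assoc] at h1
      rw [Finset.sum_congr rfl fun v hv => by rw [hm v hv]] at h1
      simp only [Finset.sum_apply, Pi.smul_apply, smul_eq_mul]
      exact_mod_cast h1
    rw [← prod_X_pow_nsmul, ← add_tsub_cancel_of_le hle', prod_X_pow_add, prod_X_pow_sum]
    refine Ideal.pow_le_pow_right hsum' (Ideal.mul_mem_right _ _ ?_)
    rw [← Finset.prod_pow_eq_pow_sum]
    refine Ideal.prod_mem_prod fun v hv => ?_
    rw [prod_X_pow_nsmul]
    exact Ideal.pow_mem_pow (Ideal.subset_span (Set.mem_image_of_mem _ (hTA hv))) _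

end MonomialIdeal

/-- **Vasconcelos.** Let `I ⊆ S = K[t_1,…,t_s]` be a monomial ideal and,
for `k ≥ 1`, let `icl k` denote the integral closure of `I^k`, i.e. the ideal generated
by all monomials `t^a` with `(t^a)^p ∈ I^{pk}` for some `p ≥ 1`.  Then
`icl n = I * icl (n-1)` for all `n ≥ s`: the filtration of integral closures of powers
of `I` stabilizes at `n = s = dim S`. -/
theorem integralClosure_powers_stabilize
    {s : ℕ} (K : Type*) [Field K] (hs : 1 ≤ s)
    (I : Ideal (MvPolynomial (Fin s) K))
    -- `I` is a monomial ideal: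
    (hmono : ∃ A : Set (Fin s → ℕ),
      I = Ideal.span ((fun a : Fin s → ℕ => (∏ i, X i ^ a i : MvPolynomial (Fin s) K)) '' A))
    (icl : ℕ → Ideal (MvPolynomial (Fin s) K))
    (hicl : ∀ k : ℕ, icl k = Ideal.span {f : MvPolynomial (Fin s) K |
      ∃ a : Fin s → ℕ, f = ∏ i, X i ^ a i ∧ ∃ p : ℕ, 1 ≤ p ∧ f ^ p ∈ I ^ (p * k)}) :
    ∀ n : ℕ, s ≤ n → icl n = I * icl (n - 1) := by
  intro n hn
  obtain ⟨A, rfl⟩ := hmono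
  have : Nonempty (Fin s) := ⟨⟨0, hs⟩⟩
  rw [hicl n, hicl (n - 1)]
  apply le_antisymm
  · rw [Ideal.span_le]
    rintro _ ⟨a, rfl, h⟩
    obtain ⟨T, hTA, c, hc, hsum, hle⟩ := (exists_pow_mem_pow_iff A a n).1 h
    obtain ⟨u, hu, hua, T', hT', h'⟩ :=
      exists_sub_combination (by simpa using hn) a T c hc hsum hle
    rw [SetLike.mem_coe, ← add_tsub_cancel_of_le hua, prod_X_pow_add]
    exact Ideal.mul_mem_mul (Ideal.subset_span ⟨u, hTA hu, rfl⟩) (Ideal.subset_span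
      ⟨a - u, rfl, (exists_pow_mem_pow_iff A (a - u) (n - 1)).2
        ⟨T', (Finset.coe_subset.2 hT').trans hTA, h'⟩⟩)
  · rw [Ideal.span_mul_span', Ideal.span_le]
    rintro _ ⟨_, ⟨v, hv, rfl⟩, _, ⟨a, rfl, p, hp, h⟩, rfl⟩
    refine Ideal.subset_span ⟨v + a, (prod_X_pow_add K v a).symm, p, hp, ?_⟩
    have hpn : p * n = p + p * (n - 1) := by
      obtain ⟨m, rfl⟩ := Nat.exists_eq_add_of_le' (hs.trans hn)
      simp [mul_add, add_comm]
    rw [hpn, pow_add]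
    dsimp only
    rw [mul_pow]
    exact Ideal.mul_mem_mul (Ideal.pow_mem_pow (Ideal.subset_span (Set.mem_image_of_mem _ hv)) p) h
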